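/- arXiv:2512.24824 — 2 statements merged into one kernel-verified Lean document; each statement's English description precedes it below -/
import Mathlib

section
/- Let k₀ ∈ ℝ, let d, R ∈ ℝ with 0 < d ≤ R, let N = ⌈R/d⌉ (the minimum layer resolution), and define SMF(x) = ⌊(x − k₀)/R · N⌋. Then for every real k_a, the images of the two endpoints of an interval of width d are separated by at least one and at most two cells: SMF(k_a) + 1 ≤ SMF(k_a + d) ≤ SMF(k_a) + 2. In particular every segment of width at least d occupies at least one cell distinct from its left endpoint's cell. -/
/-- For the scaling mapping function SMF(x) = ⌊(x − k₀)/R · N⌋ with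
N = ⌈R/d⌉ the minimum layer resolution (0 < d ≤ R), the images of the two endpoints
of any interval of width d are separated by at least one and at most two cells. -/
theorem smf_endpoint_separation (k₀ d R : ℝ) (hd : 0 < d) (hdR : d ≤ R)
    (N : ℤ) (hN : N = ⌈R / d⌉)
    (SMF : ℝ → ℤ) (hSMF : ∀ x : ℝ, SMF x = ⌊(x - k₀) / R * (N : ℝ)⌋) :
    ∀ k_a : ℝ, SMF k_a + 1 ≤ SMF (k_a + d) ∧ SMF (k_a + d) ≤ SMF k_a + 2 := by
  intro k_a
  have hR : 0 < R := hd.trans_le hdR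
  have hle : R / d ≤ N := hN ▸ Int.le_ceil _
  have hlt : (N : ℝ) < R / d + 1 := hN ▸ Int.ceil_lt_add_one _
  have hshift : (k_a + d - k₀) / R * (N : ℝ) = (k_a - k₀) / R * N + d / R * N := by ring
  have hdR_pos : 0 < d / R := div_pos hd hR
  have hcancel : d / R * (R / d) = 1 := by field_simp
  have hone : 1 ≤ d / R * N := hcancel ▸ mul_le_mul_of_nonneg_left hle hdR_pos.le
  have htwo : d / R * N < 2 := by
    have hmul := mul_lt_mul_of_pos_left hlt hdR_pos
    have hratio : d / R ≤ 1 := (div_le_one hR).2 hdR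
    linarith
  rw [hSMF, hSMF, hshift]
  constructor
  · rw [Int.le_floor]
    push_cast
    linarith [Int.floor_le ((k_a - k₀) / R * (N : ℝ))]
  · rw [← Int.lt_add_one_iff, Int.floor_lt]
    push_cast
    linarith [Int.lt_floor_add_one ((k_a - k₀) / R * (N : ℝ))]
end

section
/- Let N ∈ ℕ with N ≥ 2, let ε ∈ ℝ, let t : ℕ → ℝ be strictly increasing on {0, …, N}, and let positions be in dense layout pos_i = pos_0 + i. Define the dual upper-bound lines f_i(m) = −t_i·m + (pos_i + ε). If for every index i with 0 < i < N there exists m ∈ ℝ with f_i(m) < f_{i−1}(m) and f_i(m) < f_{i+1}(m) (i.e., every data point contributes a unique vertex to the upper boundary of the feasible convex hull), then the sequence of key intervals Δt_i = t_{i+1} − t_i is strictly monotonically decreasing for i = 0, …, N−1. -/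
/-- If, under dense layout pos_i = pos₀ + i with keys strictly increasing on
{0,…,N}, every interior data point's dual upper-bound line f_i(m) = −t_i·m + (pos_i + ε)
is strictly below its neighbors somewhere (contributes a vertex to the upper boundary),
then the key intervals Δt_i = t_{i+1} − t_i are strictly monotonically decreasing on
{0,…,N−1}. -/
theorem all_vertices_imp_decreasing_gaps (N : ℕ) (hN : 2 ≤ N) (ε p₀ : ℝ) (t : ℕ → ℝ)
    (ht : StrictMonoOn t (Set.Icc 0 N))
    (f : ℕ → ℝ → ℝ) (hf : ∀ i m, f i m = -t i * m + ((p₀ + (i : ℝ)) + ε))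
    (hvertex : ∀ i, 0 < i → i < N → ∃ m : ℝ, f i m < f (i - 1) m ∧ f i m < f (i + 1) m) :
    StrictAntiOn (fun i => t (i + 1) - t i) (Set.Icc 0 (N - 1)) := by
  have step : ∀ i, i + 1 < N → t (i + 2) - t (i + 1) < t (i + 1) - t i := by
    intro i hi
    obtain ⟨m, hleft, hright⟩ := hvertex (i + 1) i.succ_pos hi
    have hgap : t i < t (i + 1) := ht ⟨by lia, by lia⟩ ⟨by lia, by lia⟩ (by lia)
    rw [Nat.add_sub_cancel, hf, hf] at hleft
    rw [hf, hf] at hright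
    push_cast at hleft hright
    have hone : 1 < (t (i + 1) - t i) * m := by linarith
    have hm : 0 < m := pos_of_mul_pos_right (zero_lt_one.trans hone) (sub_pos.2 hgap).le
    refine lt_of_mul_lt_mul_right (a := m) ?_ hm.le
    linarith
  intro a _ b hb hab
  have hbN : b < N := by have := hb.2; lia
  clear hb
  induction b, hab using Nat.le_induction with
  | base => exact step a hbN
  | succ n _ ih => exact (step n hbN).trans (ih (by lia))
end
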